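/- Let $X \sim \mathrm{Beta}(\alpha,\beta)$ with $\alpha,\beta \ge 1$ and $p = \alpha/(\alpha+\beta)$. Then for any $\varepsilon \in (0, 1-p)$, $\Pr(X \ge p + \varepsilon) \le \exp(-2(\alpha+\beta-1)\varepsilon^2)$. -/

import Mathlib

open MeasureTheory Real

/-- The density of the Beta distribution with parameters `a`, `b` on `(0,1)`. -/
noncomputable def betaPDFReal (a b x : ℝ) : ℝ :=
  if x ∈ Set.Ioo (0 : ℝ) 1 then
    (Real.Gamma (a + b) / (Real.Gamma a * Real.Gamma b)) * x ^ (a - 1) * (1 - x) ^ (b - 1)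
  else 0

/-- The Beta distribution with parameters `a`, `b`. -/
noncomputable def betaMeasure (a b : ℝ) : Measure ℝ :=
  volume.withDensity (fun x => ENNReal.ofReal (betaPDFReal a b x))

lemma lintegral_betaPDFReal_eq_one {a b : ℝ} (ha : 0 < a) (hb : 0 < b) :
    ∫⁻ x, ENNReal.ofReal (betaPDFReal a b x) = 1 := by
  rw [← ProbabilityTheory.lintegral_betaPDF_eq_one ha hb]
  refine lintegral_congr fun x => ?_
  rw [ProbabilityTheory.betaPDF_eq, betaPDFReal, ProbabilityTheory.beta, one_div_div]
  rfl

lemma betaPDFReal_nonneg {a b : ℝ} (ha : 0 < a) (hb : 0 < b) (x : ℝ) :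
    0 ≤ betaPDFReal a b x := by
  unfold betaPDFReal
  split_ifs with h
  · have := Real.Gamma_pos_of_pos ha
    have := Real.Gamma_pos_of_pos hb
    have := Real.Gamma_pos_of_pos (add_pos ha hb)
    have := Real.rpow_nonneg h.1.le (a - 1)
    have := Real.rpow_nonneg (sub_nonneg.2 h.2.le) (b - 1)
    positivity
  · exact le_rfl

lemma lintegral_eq_lintegral_comp_affine {k : ℝ} (hk : 0 < k) (c : ℝ) {g : ℝ → ENNReal}
    (hg : Measurable g) :
    ∫⁻ u, g u = ∫⁻ t, ENNReal.ofReal k * g (c + k * t) := by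
  rw [lintegral_const_mul _ (by fun_prop), ← lintegral_add_left_eq_self g c]
  conv_lhs => rw [← Real.smul_map_volume_mul_left hk.ne']
  rw [lintegral_smul_measure, lintegral_map (by fun_prop) (by fun_prop), abs_of_pos hk,
    smul_eq_mul]

/-- The affine map fixing `1` and sending `y` to `x` compares the density of a Beta distribution
on `[x, 1)` with its density on `[y, 1)`. -/
lemma betaPDFReal_comp_affine_le {a b x y t : ℝ} (ha : 1 ≤ a) (hb : 0 < b) (hy : 0 < y)
    (hyx : y ≤ x) (hx : x < 1) (ht : y ≤ t) (ht1 : t < 1) :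
    (1 - x) / (1 - y) *
        betaPDFReal a b (1 - (1 - x) / (1 - y) + (1 - x) / (1 - y) * t) ≤
      ((1 - x) / (1 - y)) ^ b * (x / y) ^ (a - 1) * betaPDFReal a b t := by
  have hy1 : 0 < 1 - y := by linarith
  set k := (1 - x) / (1 - y) with hk
  have hk0 : 0 < k := div_pos (by linarith) hy1
  have hk1 : k ≤ 1 := (div_le_one hy1).2 (by linarith)
  have hky : k * (1 - y) = 1 - x := div_mul_cancel₀ _ hy1.ne'
  have ht0 : 0 < t := hy.trans_le ht
  have hlow : x ≤ 1 - k + k * t := by nlinarith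
  have hup : 1 - k + k * t < 1 := by nlinarith
  have hT : 1 - k + k * t ≤ x / y * t := by
    rw [div_mul_eq_mul_div x, le_div_iff₀ hy]
    nlinarith [mul_nonneg (sub_nonneg.2 ht) (sub_nonneg.2 hk1)]
  have hx0 : 0 < x := hy.trans_le hyx
  have hpow : (1 - k + k * t) ^ (a - 1) ≤ (x / y) ^ (a - 1) * t ^ (a - 1) := by
    rw [← Real.mul_rpow (by positivity) ht0.le]
    exact Real.rpow_le_rpow (by linarith) hT (by linarith)
  have hone : (1 - (1 - k + k * t)) ^ (b - 1) = k ^ (b - 1) * (1 - t) ^ (b - 1) := by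
    rw [← Real.mul_rpow hk0.le (by linarith)]
    ring_nf
  have hkb : k ^ b = k * k ^ (b - 1) := by
    rw [Real.rpow_sub_one hk0.ne', mul_div_cancel₀ _ hk0.ne']
  have hC : 0 ≤ Real.Gamma (a + b) / (Real.Gamma a * Real.Gamma b) := by
    have := Real.Gamma_pos_of_pos (by linarith : 0 < a)
    have := Real.Gamma_pos_of_pos hb
    have := Real.Gamma_pos_of_pos (by linarith : 0 < a + b)
    positivity
  rw [betaPDFReal, if_pos ⟨by linarith, hup⟩, betaPDFReal, if_pos ⟨ht0, ht1⟩, hone, hkb]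
  have hnn : 0 ≤ k * (Real.Gamma (a + b) / (Real.Gamma a * Real.Gamma b)) *
      (k ^ (b - 1) * (1 - t) ^ (b - 1)) := by
    have := Real.rpow_nonneg (sub_nonneg.2 ht1.le) (b - 1)
    positivity
  calc _ = k * (Real.Gamma (a + b) / (Real.Gamma a * Real.Gamma b)) *
        (k ^ (b - 1) * (1 - t) ^ (b - 1)) * (1 - k + k * t) ^ (a - 1) := by ring
    _ ≤ _ := mul_le_mul_of_nonneg_left hpow hnn
    _ = _ := by ring

lemma betaMeasure_Ici_le {a b x y : ℝ} (ha : 1 ≤ a) (hb : 0 < b) (hy : 0 < y)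
    (hyx : y ≤ x) (hx : x < 1) :
    betaMeasure a b (Set.Ici x) ≤
      ENNReal.ofReal (((1 - x) / (1 - y)) ^ b * (x / y) ^ (a - 1)) := by
  have hy1 : 0 < 1 - y := by linarith
  have ha0 : 0 < a := by linarith
  have hmeas : Measurable (betaPDFReal a b) :=
    Measurable.ite measurableSet_Ioo (by fun_prop) (by fun_prop)
  have hC : 0 ≤ ((1 - x) / (1 - y)) ^ b * (x / y) ^ (a - 1) := by
    have h1 : 0 ≤ 1 - x := by linarith
    have h2 : 0 ≤ x := by linarith
    positivity
  have hk0 : 0 < (1 - x) / (1 - y) := div_pos (by linarith) hy1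
  have hky : (1 - x) / (1 - y) * (1 - y) = 1 - x := div_mul_cancel₀ _ hy1.ne'
  rw [betaMeasure, withDensity_apply _ measurableSet_Ici, ← lintegral_indicator measurableSet_Ici,
    lintegral_eq_lintegral_comp_affine hk0 (1 - (1 - x) / (1 - y))
      ((by fun_prop : Measurable _).indicator measurableSet_Ici)]
  calc _ ≤ ∫⁻ t, ENNReal.ofReal (((1 - x) / (1 - y)) ^ b * (x / y) ^ (a - 1)) *
        ENNReal.ofReal (betaPDFReal a b t) := by
        refine lintegral_mono fun t => ?_
        by_cases hm : x ≤ 1 - (1 - x) / (1 - y) + (1 - x) / (1 - y) * t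
        · rw [Set.indicator_of_mem (Set.mem_Ici.2 hm), ← ENNReal.ofReal_mul hk0.le,
            ← ENNReal.ofReal_mul hC]
          refine ENNReal.ofReal_le_ofReal ?_
          have ht : y ≤ t := by
            by_contra! h
            nlinarith
          rcases lt_or_ge t 1 with h1 | h1
          · exact betaPDFReal_comp_affine_le ha hb hy hyx hx ht h1
          · rw [betaPDFReal, if_neg, mul_zero]
            · exact mul_nonneg hC (betaPDFReal_nonneg ha0 hb t)
            · rintro ⟨-, h⟩
              nlinarith
        · rw [Set.indicator_of_notMem (by simpa using hm), mul_zero]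
          exact zero_le
    _ = _ := by
        rw [lintegral_const_mul _ (by fun_prop), lintegral_betaPDFReal_eq_one ha0 hb, mul_one]

lemma rpow_mul_rpow_le_exp {a b p x : ℝ} (ha : 1 ≤ a) (hb : 0 < b) (hp : p = a / (a + b))
    (hpx : p ≤ x) (hx : x < 1) :
    ((1 - x) / (1 - p)) ^ b * (x / p) ^ (a - 1) ≤
      Real.exp (-2 * (a + b - 1) * (x - p) ^ 2) := by
  have hp0 : 0 < p := by rw [hp]; positivity
  have hp1 : 0 < 1 - p := by linarith
  have hx0 : 0 < x := by linarith
  have hpab : p * (a + b) = a := by rw [hp]; field_simp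
  have hder : ∀ y ∈ Set.Icc p x, HasDerivAt
      (fun y => b * Real.log (1 - y) + (a - 1) * Real.log y + 2 * (a + b - 1) * (y - p) ^ 2)
      (b * (-1 / (1 - y)) + (a - 1) * (1 / y) + 2 * (a + b - 1) * (2 * (y - p))) y := by
    intro y hy
    have h1 : HasDerivAt (fun y : ℝ => Real.log (1 - y)) (-1 / (1 - y)) y :=
      ((hasDerivAt_id y).const_sub 1).log (by simp only [id]; linarith [hy.2])
    have h2 : HasDerivAt (fun y : ℝ => Real.log y) (1 / y) y :=
      (hasDerivAt_id y).log (by simp only [id]; linarith [hy.1])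
    have h3 : HasDerivAt (fun y : ℝ => (y - p) ^ 2) (2 * (y - p)) y := by
      simpa using ((hasDerivAt_id y).sub_const p).fun_pow 2
    exact ((h1.const_mul b).add (h2.const_mul (a - 1))).add (h3.const_mul _)
  have hanti := antitoneOn_of_deriv_nonpos (convex_Icc p x)
    (fun y hy => (hder y hy).continuousAt.continuousWithinAt)
    (fun y hy => (hder y (interior_subset hy)).differentiableAt.differentiableWithinAt)
    (fun y hy => by
      have hy' := interior_subset hy
      rw [(hder y hy').deriv]
      have hy0 : 0 < y := by linarith [hy'.1]
      have hy1 : 0 < 1 - y := by linarith [hy'.2]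
      have hn : 0 ≤ (a + b - 1) * (y - p) :=
        mul_nonneg (by linarith) (by linarith [hy'.1])
      have key : b * (-1 / (1 - y)) + (a - 1) * (1 / y) + 2 * (a + b - 1) * (2 * (y - p)) =
          ((a - 1) - (a + b - 1) * y + 4 * (y * (1 - y)) * ((a + b - 1) * (y - p))) /
            (y * (1 - y)) := by
        field_simp
        ring
      rw [key]
      refine div_nonpos_of_nonpos_of_nonneg ?_ (by positivity)
      nlinarith [mul_nonneg hn (sq_nonneg (2 * y - 1))])
  have hle := hanti (Set.left_mem_Icc.2 hpx) (Set.right_mem_Icc.2 hpx) hpx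
  have h1 : 0 < (1 - x) / (1 - p) := div_pos (by linarith) hp1
  have h2 : 0 < x / p := by positivity
  rw [Real.rpow_def_of_pos h1, Real.rpow_def_of_pos h2, ← Real.exp_add, Real.exp_le_exp,
    Real.log_div (by linarith) hp1.ne', Real.log_div hx0.ne' hp0.ne']
  simp only [sub_self] at hle
  nlinarith

/-- Upper tail bound for the Beta distribution (Lemma 1 of the paper, upper tail):
for `X ~ Beta(a,b)` with `a, b ≥ 1` and `p = a/(a+b)`, for any `ε ∈ (0, 1-p)`,
`Pr(X ≥ p + ε) ≤ exp (-2(a+b-1)ε²)`. -/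
theorem beta_upper_tail_bound
    (a b : ℝ) (ha : 1 ≤ a) (hb : 1 ≤ b)
    (p : ℝ) (hp : p = a / (a + b))
    (ε : ℝ) (hε : ε ∈ Set.Ioo 0 (1 - p)) :
    betaMeasure a b {x | p + ε ≤ x} ≤
      ENNReal.ofReal (Real.exp (-2 * (a + b - 1) * ε ^ 2)) := by
  have hb0 : 0 < b := by linarith
  have hp0 : 0 < p := by rw [hp]; positivity
  obtain ⟨hε0, hε1⟩ := hε
  refine (betaMeasure_Ici_le ha hb0 hp0 (by linarith) (by linarith)).trans
    (ENNReal.ofReal_le_ofReal ?_)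
  simpa using rpow_mul_rpow_le_exp ha hb0 hp (x := p + ε) (by linarith) (by linarith)
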